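/- For all integers m ≥ 1 and i, j ≥ 1, the stiffness integral satisfies ∫_0^1 [ (m²/r) h_i^m(r) h_j^m(r) + (h_i^m)'(r) (h_j^m)'(r) r ] dr = μ_i^m μ_j^m ( m + 2(min(i,j) − 1)(min(i,j) + m) ). -/

import Mathlib

open MeasureTheory intervalIntegral

/-- The Jacobi polynomial `P_n^{(0,m)}` via the Rodrigues formula
`P_n^{(0,m)}(x) = ((−1)ⁿ/(2ⁿ n!)) (1+x)^{−m} (d/dx)ⁿ [ (1−x)ⁿ (1+x)^{n+m} ]`. -/
noncomputable def jacobi0 (n m : ℕ) (x : ℝ) : ℝ :=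
  ((-1:ℝ)^n / ((2:ℝ)^n * (Nat.factorial n : ℝ))) *
    iteratedDeriv n (fun y : ℝ => (1 - y)^n * (1 + y)^(n + m)) x / (1 + x)^m

/-- `μ_j^m = 2√(j + (m−1)/2)`. -/
noncomputable def muC (j m : ℕ) : ℝ := 2 * Real.sqrt ((j:ℝ) + ((m:ℝ) - 1)/2)

/-- The radial polynomial `h_j^m(r) = μ_j^m r^m P_{j−1}^{(0,m)}(2r² − 1)`. -/
noncomputable def hRad (j m : ℕ) (r : ℝ) : ℝ :=
  muC j m * r^m * jacobi0 (j - 1) m (2*r^2 - 1)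

open Polynomial in
/-- The polynomial `(1 - X)ⁿ (1 + X)ⁿ⁺ᵐ` differentiated in the Rodrigues formula. -/
noncomputable def rodriguesKernel (n m : ℕ) : ℝ[X] := (1 - X) ^ n * (X + C 1) ^ (n + m)

open Polynomial in
/-- The Jacobi polynomial `P_n^{(0,m)}` as an element of `ℝ[X]`. -/
noncomputable def jacobiPoly (n m : ℕ) : ℝ[X] :=
  C ((-1) ^ n / (2 ^ n * (n.factorial : ℝ))) *
    (derivative^[n] (rodriguesKernel n m) /ₘ (X + C 1) ^ m)

open Polynomial in
theorem pow_mul_jacobiPoly (n m : ℕ) :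
    (X + C 1) ^ m * jacobiPoly n m =
      C ((-1) ^ n / (2 ^ n * (n.factorial : ℝ))) * derivative^[n] (rodriguesKernel n m) := by
  have hdvd : (X + C 1 : ℝ[X]) ^ m ∣ derivative^[n] (rodriguesKernel n m) := by
    have h := pow_sub_dvd_iterate_derivative_of_pow_dvd (p := rodriguesKernel n m)
      (q := (X + C 1 : ℝ[X])) (n := n + m) n (Dvd.intro_left _ rfl)
    rwa [Nat.add_sub_cancel_left] at h
  have hmonic : ((X + C 1 : ℝ[X]) ^ m).Monic := (monic_X_add_C 1).pow m
  have h := (modByMonic_eq_zero_iff_dvd hmonic).mpr hdvd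
  have h2 := modByMonic_add_div (derivative^[n] (rodriguesKernel n m)) ((X + C 1 : ℝ[X]) ^ m)
  rw [h, zero_add] at h2
  rw [jacobiPoly, mul_left_comm, h2]

open Polynomial in
theorem Polynomial.iteratedDeriv_eval (p : ℝ[X]) (n : ℕ) :
    iteratedDeriv n (fun x => p.eval x) = fun x => (derivative^[n] p).eval x := by
  induction n with
  | zero => simp
  | succ n ih =>
    rw [iteratedDeriv_succ, ih, Function.iterate_succ_apply']
    ext x
    exact Polynomial.deriv _

open Polynomial in
theorem jacobi0_eq_eval {n m : ℕ} {x : ℝ} (hx : 1 + x ≠ 0) :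
    jacobi0 n m x = (jacobiPoly n m).eval x := by
  have hW : (fun y : ℝ => (1 - y) ^ n * (1 + y) ^ (n + m)) =
      fun y => (rodriguesKernel n m).eval y := by
    ext y
    simp [rodriguesKernel, add_comm]
  have h := congrArg (Polynomial.eval x) (pow_mul_jacobiPoly n m)
  simp only [eval_mul, eval_pow, eval_add, eval_X, eval_C] at h
  rw [jacobi0, hW, Polynomial.iteratedDeriv_eval, ← h, add_comm x 1,
    mul_div_cancel_left₀ _ (pow_ne_zero m hx)]

open Polynomial in
theorem natDegree_jacobiPoly_le (n m : ℕ) : (jacobiPoly n m).natDegree ≤ n := by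
  have hmonic : ((X + C 1 : ℝ[X]) ^ m).Monic := (monic_X_add_C 1).pow m
  have hW : (rodriguesKernel n m).natDegree ≤ n * 1 + (n + m) * 1 := by
    refine natDegree_mul_le_of_le (natDegree_pow_le_of_le _ ?_) (natDegree_pow_le_of_le _ ?_)
    · compute_degree
    · compute_degree
  have h1 := natDegree_iterate_derivative (rodriguesKernel n m) n
  refine (natDegree_C_mul_le _ _).trans ?_
  rw [natDegree_divByMonic _ hmonic, natDegree_pow, natDegree_X_add_C]
  omega

open Polynomial in
theorem Polynomial.eval_iterate_derivative_one_sub_X_pow_mul (n k : ℕ) (V : ℝ[X]) :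
    (derivative^[n + k] ((1 - X) ^ n * V)).eval 1 =
      ((n + k).factorial : ℝ) * ((-1) ^ n * (taylor 1 V).coeff k) := by
  rw [← factorial_smul_hasseDeriv]
  rw [LinearMap.smul_apply, eval_smul, ← taylor_coeff, taylor_mul, taylor_pow]
  have h : taylor (1 : ℝ) (1 - X) = C (-1) * X := by
    simp [taylor_apply]
  rw [h, mul_pow, ← C_pow, mul_assoc, coeff_C_mul, add_comm n k, coeff_X_pow_mul, nsmul_eq_mul]

open Polynomial in
theorem eval_one_jacobiPoly (n m : ℕ) : (jacobiPoly n m).eval 1 = 1 := by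
  have h := congrArg (Polynomial.eval 1) (pow_mul_jacobiPoly n m)
  have h1 := Polynomial.eval_iterate_derivative_one_sub_X_pow_mul n 0 ((X + C 1) ^ (n + m))
  rw [add_zero, taylor_coeff_zero] at h1
  rw [eval_mul, eval_mul, rodriguesKernel, h1] at h
  simp only [eval_pow, eval_add, eval_X, eval_C] at h
  have hn : (n.factorial : ℝ) ≠ 0 := by positivity
  have hs : ((-1 : ℝ) ^ n) * (-1) ^ n = 1 := by rw [← mul_pow]; norm_num
  have h2 : ((1 : ℝ) + 1) = 2 := by norm_num
  rw [h2] at h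
  have h3 : (2 : ℝ) ^ m * eval 1 (jacobiPoly n m) = 2 ^ m * 1 := by
    rw [h, pow_add]
    field_simp
    linear_combination hs
  exact mul_left_cancel₀ (by positivity) h3

open Polynomial in
theorem eval_one_derivative_jacobiPoly (n k : ℕ) :
    (derivative (jacobiPoly n (k + 1))).eval 1 = n * (n + k + 2) / 2 := by
  have h := congrArg (fun p => (derivative p).eval 1) (pow_mul_jacobiPoly n (k + 1))
  have h1 := Polynomial.eval_iterate_derivative_one_sub_X_pow_mul n 1 ((X + C 1) ^ (n + (k + 1)))
  rw [taylor_coeff_one] at h1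
  simp only [derivative_mul, derivative_C, zero_mul, zero_add, ← Function.iterate_succ_apply'] at h
  rw [eval_add, eval_mul, eval_mul, eval_mul, rodriguesKernel, h1, eval_one_jacobiPoly] at h
  simp only [derivative_pow, derivative_add, derivative_X, derivative_C, eval_pow, eval_add,
    eval_mul, eval_X, eval_C, eval_one, Nat.factorial_succ, add_zero,
    Nat.add_sub_cancel, ← add_assoc] at h
  have hn : (n.factorial : ℝ) ≠ 0 := by positivity
  have hs : ((-1 : ℝ) ^ n) * (-1) ^ n = 1 := by rw [← mul_pow]; norm_num
  have h2 : ((1 : ℝ) + 1) = 2 := by norm_num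
  rw [h2] at h
  push_cast at h
  have h3 : (2 : ℝ) ^ (k + 1) * eval 1 (derivative (jacobiPoly n (k + 1))) =
      2 ^ (k + 1) * (n * (n + k + 2) / 2) := by
    have h4 : (-1 : ℝ) ^ n / (2 ^ n * n.factorial) * ((n + 1) * n.factorial *
        ((-1) ^ n * ((n + k + 1) * 2 ^ (n + k)))) = (n + 1) * (n + k + 1) * 2 ^ k := by
      rw [pow_add]
      field_simp
      linear_combination hs
    simp only [mul_one] at h
    rw [h4] at h
    rw [pow_succ] at h ⊢
    linear_combination h
  exact mul_left_cancel₀ (by positivity) h3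

open Polynomial in
theorem Polynomial.integral_iterate_derivative_mul_eq_zero {a b : ℝ} {W : ℝ[X]} (n : ℕ)
    (ha : ∀ k < n, (derivative^[k] W).eval a = 0) (hb : ∀ k < n, (derivative^[k] W).eval b = 0)
    (R : ℝ[X]) (hR : derivative^[n] R = 0) :
    ∫ x in a..b, (derivative^[n] W).eval x * R.eval x = 0 := by
  induction n generalizing R with
  | zero =>
    have : R = 0 := hR
    simp [this]
  | succ n ih =>
    have h := ih (fun k hk => ha k (by omega)) (fun k hk => hb k (by omega)) (derivative R)
      (by rwa [← Function.iterate_succ_apply])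
    have hparts := intervalIntegral.integral_deriv_mul_eq_sub (a := a) (b := b)
      (fun x _ => (derivative^[n] W).hasDerivAt x) (fun x _ => R.hasDerivAt x)
      ((Polynomial.continuous _).intervalIntegrable _ _)
      ((Polynomial.continuous _).intervalIntegrable _ _)
    rw [intervalIntegral.integral_add (Continuous.intervalIntegrable (by fun_prop) _ _)
      (Continuous.intervalIntegrable (by fun_prop) _ _),
      h, ha n (by omega), hb n (by omega)] at hparts
    rw [Function.iterate_succ_apply']
    simpa using hparts

open Polynomial in
/-- `P_n^{(0,m)}` is orthogonal to lower-degree polynomials for the weight `(1 + x)^m`. -/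
theorem integral_jacobiPoly_mul_eq_zero (n m : ℕ) (R : ℝ[X]) (hR : derivative^[n] R = 0) :
    ∫ x in (-1 : ℝ)..1, (1 + x) ^ m * (jacobiPoly n m).eval x * R.eval x = 0 := by
  have h := Polynomial.integral_iterate_derivative_mul_eq_zero (a := -1) (b := 1)
    (W := rodriguesKernel n m) n ?_ ?_ R hR
  · have heq : ∀ x : ℝ, (1 + x) ^ m * (jacobiPoly n m).eval x * R.eval x =
        (-1) ^ n / (2 ^ n * (n.factorial : ℝ)) *
          ((derivative^[n] (rodriguesKernel n m)).eval x * R.eval x) := by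
      intro x
      have h := congrArg (Polynomial.eval x) (pow_mul_jacobiPoly n m)
      simp only [eval_mul, eval_pow, eval_add, eval_X, eval_C] at h
      rw [add_comm 1 x, h, mul_assoc]
    simp only [heq]
    rw [intervalIntegral.integral_const_mul, h, mul_zero]
  · intro k hk
    have hd := pow_sub_dvd_iterate_derivative_of_pow_dvd (p := rodriguesKernel n m)
      (q := (X + C 1 : ℝ[X])) (n := n + m) k (Dvd.intro_left _ rfl)
    refine eval_eq_zero_of_dvd_of_eval_eq_zero hd ?_
    have : n + m - k ≠ 0 := by omega
    simp [this]
  · intro k hk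
    have hd := pow_sub_dvd_iterate_derivative_of_pow_dvd (p := rodriguesKernel n m)
      (q := (1 - X : ℝ[X])) (n := n) k (Dvd.intro _ rfl)
    refine eval_eq_zero_of_dvd_of_eval_eq_zero hd ?_
    have : n - k ≠ 0 := by omega
    simp [this]

open Polynomial in
theorem iterate_derivative_jacobiPoly_remainder {n l : ℕ} (m : ℕ) (c : ℝ) (h : n ≤ l) :
    derivative^[l] (C c * derivative (jacobiPoly n m) +
      (X + C 1) * derivative (derivative (jacobiPoly n m))) = 0 := by
  have hdeg := natDegree_jacobiPoly_le n m
  rcases Nat.eq_zero_or_pos n with rfl | hn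
  · have : derivative (jacobiPoly 0 m) = 0 :=
      derivative_of_natDegree_zero (Nat.le_zero.mp hdeg)
    simp [this]
  · apply iterate_derivative_eq_zero
    have h1 := natDegree_derivative_le (jacobiPoly n m)
    have h2 := natDegree_derivative_le (derivative (jacobiPoly n m))
    by_cases h0 : n = 1
    · subst h0
      have h3 : derivative (derivative (jacobiPoly 1 m)) = 0 :=
        derivative_of_natDegree_zero (by omega)
      rw [h3, mul_zero, add_zero]
      exact (natDegree_C_mul_le _ _).trans_lt (by omega)
    · refine (natDegree_add_le_of_degree_le (n := n - 1) ?_ ?_).trans_lt (by omega)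
      · exact (natDegree_C_mul_le _ _).trans (by omega)
      · refine natDegree_mul_le.trans ?_
        rw [natDegree_X_add_C]
        omega

open Polynomial in
theorem hasDerivAt_eval_two_mul_sq_sub_one (P : ℝ[X]) (r : ℝ) :
    HasDerivAt (fun r : ℝ => P.eval (2 * r ^ 2 - 1))
      ((derivative P).eval (2 * r ^ 2 - 1) * (4 * r)) r := by
  have h : HasDerivAt (fun r : ℝ => 2 * r ^ 2 - 1) (4 * r) r := by
    refine (((hasDerivAt_pow 2 r).const_mul 2).sub_const 1).congr_deriv ?_
    norm_num [← mul_assoc]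
  exact (P.hasDerivAt (2 * r ^ 2 - 1)).comp r h

theorem hRad_eq_eval (j m : ℕ) {r : ℝ} (hr : 0 < r) :
    hRad j m r = muC j m * (r ^ m * (jacobiPoly (j - 1) m).eval (2 * r ^ 2 - 1)) := by
  rw [hRad, jacobi0_eq_eval (by rw [add_sub_cancel]; positivity), mul_assoc]

open Polynomial in
theorem deriv_hRad (j k : ℕ) {r : ℝ} (hr : 0 < r) :
    deriv (hRad j (k + 1)) r = muC j (k + 1) *
      ((k + 1) * r ^ k * (jacobiPoly (j - 1) (k + 1)).eval (2 * r ^ 2 - 1) +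
        r ^ (k + 1) *
          ((derivative (jacobiPoly (j - 1) (k + 1))).eval (2 * r ^ 2 - 1) * (4 * r))) := by
  have heq : hRad j (k + 1) =ᶠ[nhds r] fun r => muC j (k + 1) *
      (r ^ (k + 1) * (jacobiPoly (j - 1) (k + 1)).eval (2 * r ^ 2 - 1)) := by
    filter_upwards [lt_mem_nhds hr] with x hx
    exact hRad_eq_eval j (k + 1) hx
  rw [heq.deriv_eq]
  have h := ((hasDerivAt_pow (k + 1) r).mul
    (hasDerivAt_eval_two_mul_sq_sub_one (jacobiPoly (j - 1) (k + 1)) r)).const_mul (muC j (k + 1))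
  simpa using h.deriv

open Polynomial in
theorem integral_stiffness_eval (k : ℕ) (P Q : ℝ[X])
    (horth : ∫ x in (-1 : ℝ)..1, (1 + x) ^ (k + 1) * Q.eval x *
      (C ((k : ℝ) + 2) * derivative P + (X + C 1) * derivative (derivative P)).eval x = 0) :
    ∫ r in (0 : ℝ)..1, (2 * (k + 1) ^ 2 * r ^ (2 * k + 1) *
          (P.eval (2 * r ^ 2 - 1) * Q.eval (2 * r ^ 2 - 1)) +
        4 * (k + 1) * r ^ (2 * k + 3) * ((derivative P).eval (2 * r ^ 2 - 1) *
          Q.eval (2 * r ^ 2 - 1) + P.eval (2 * r ^ 2 - 1) * (derivative Q).eval (2 * r ^ 2 - 1)) +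
        16 * r ^ (2 * k + 5) *
          ((derivative P).eval (2 * r ^ 2 - 1) * (derivative Q).eval (2 * r ^ 2 - 1))) =
      ((k : ℝ) + 1) * P.eval 1 * Q.eval 1 + 4 * (derivative P).eval 1 * Q.eval 1 := by
  set G : ℝ[X] := (X + C 1) ^ (k + 1) * Q *
    (C ((k : ℝ) + 2) * derivative P + (X + C 1) * derivative (derivative P)) with hG
  have hsub := intervalIntegral.integral_comp_mul_deriv (a := 0) (b := 1)
    (f := fun r : ℝ => 2 * r ^ 2 - 1) (f' := fun r => 4 * r) (g := fun x => G.eval x)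
    (fun r _ => by
      simpa using hasDerivAt_eval_two_mul_sq_sub_one X r)
    (by fun_prop) (Polynomial.continuous G)
  have hGzero : ∫ x in (-1 : ℝ)..1, G.eval x = 0 := by
    rw [← horth]
    refine intervalIntegral.integral_congr fun x _ => ?_
    simp [hG, add_comm x 1]
  norm_num only at hsub
  rw [hGzero] at hsub
  have hFTC := intervalIntegral.integral_eq_sub_of_hasDerivAt (a := 0) (b := 1)
    (f := fun r : ℝ => ((k : ℝ) + 1) * (r ^ (2 * k + 2) *
        (P.eval (2 * r ^ 2 - 1) * Q.eval (2 * r ^ 2 - 1))) +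
      4 * (r ^ (2 * k + 4) * ((derivative P).eval (2 * r ^ 2 - 1) * Q.eval (2 * r ^ 2 - 1))))
    (f' := fun r : ℝ => (2 * (k + 1) ^ 2 * r ^ (2 * k + 1) *
          (P.eval (2 * r ^ 2 - 1) * Q.eval (2 * r ^ 2 - 1)) +
        4 * (k + 1) * r ^ (2 * k + 3) * ((derivative P).eval (2 * r ^ 2 - 1) *
          Q.eval (2 * r ^ 2 - 1) + P.eval (2 * r ^ 2 - 1) * (derivative Q).eval (2 * r ^ 2 - 1)) +
        16 * r ^ (2 * k + 5) *
          ((derivative P).eval (2 * r ^ 2 - 1) * (derivative Q).eval (2 * r ^ 2 - 1))) +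
      2 / 2 ^ (k + 1) * (((fun x => G.eval x) ∘ fun r : ℝ => 2 * r ^ 2 - 1) r * (4 * r)))
    (fun r _ => by
      have h := (((hasDerivAt_pow (2 * k + 2) r).mul
          ((hasDerivAt_eval_two_mul_sq_sub_one P r).mul
            (hasDerivAt_eval_two_mul_sq_sub_one Q r))).const_mul ((k : ℝ) + 1)).add
        (((hasDerivAt_pow (2 * k + 4) r).mul
          ((hasDerivAt_eval_two_mul_sq_sub_one (derivative P) r).mul
            (hasDerivAt_eval_two_mul_sq_sub_one Q r))).const_mul 4)
      refine h.congr_deriv ?_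
      have hx : 2 * r ^ 2 - 1 + 1 = 2 * r ^ 2 := by ring
      simp only [hG, Function.comp_apply, eval_mul, eval_add, eval_pow, eval_X, eval_C, hx,
        mul_pow, Pi.mul_apply, Nat.add_succ_sub_one]
      push_cast
      field_simp
      ring)
    (Continuous.intervalIntegrable (by fun_prop) _ _)
  rw [intervalIntegral.integral_add (Continuous.intervalIntegrable (by fun_prop) _ _)
      (Continuous.intervalIntegrable (by fun_prop) _ _),
    intervalIntegral.integral_const_mul, hsub, mul_zero, add_zero] at hFTC
  rw [hFTC]
  norm_num
  ring

theorem hRad_stiffness_of_le (k : ℕ) {i j : ℕ} (hi : 1 ≤ i) (hij : i ≤ j) :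
    (∫ r in (0:ℝ)..1, (((k + 1 : ℕ) : ℝ) ^ 2 / r * (hRad i (k + 1) r * hRad j (k + 1) r) +
        deriv (hRad i (k + 1)) r * deriv (hRad j (k + 1)) r * r)) =
      muC i (k + 1) * muC j (k + 1) *
        (((k + 1 : ℕ) : ℝ) + 2 * ((i : ℝ) - 1) * ((i : ℝ) + ((k + 1 : ℕ) : ℝ))) := by
  have hint := integral_stiffness_eval k (jacobiPoly (i - 1) (k + 1)) (jacobiPoly (j - 1) (k + 1))
    (integral_jacobiPoly_mul_eq_zero _ _ _
      (iterate_derivative_jacobiPoly_remainder _ _ (Nat.sub_le_sub_right hij 1)))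
  rw [eval_one_jacobiPoly, eval_one_jacobiPoly, eval_one_derivative_jacobiPoly,
    Nat.cast_sub hi] at hint
  rw [show muC i (k + 1) * muC j (k + 1) *
        (((k + 1 : ℕ) : ℝ) + 2 * ((i : ℝ) - 1) * ((i : ℝ) + ((k + 1 : ℕ) : ℝ))) =
      muC i (k + 1) * muC j (k + 1) * (((k : ℝ) + 1) * 1 * 1 +
        4 * (((i : ℝ) - (1 : ℕ)) * ((i : ℝ) - (1 : ℕ) + k + 2) / 2) * 1) by push_cast; ring,
    ← hint, ← intervalIntegral.integral_const_mul]
  refine intervalIntegral.integral_congr_Ioo_of_le zero_le_one fun r hr => ?_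
  have hr0 : r ≠ 0 := hr.1.ne'
  simp only [hRad_eq_eval _ _ hr.1, deriv_hRad _ _ hr.1]
  push_cast
  field_simp
  ring

/-- for `m ≥ 1` and `i, j ≥ 1`, the stiffness integral satisfies
`∫_0^1 [ (m²/r) h_i^m h_j^m + (h_i^m)' (h_j^m)' r ] dr
  = μ_i^m μ_j^m ( m + 2(min(i,j) − 1)(min(i,j) + m) )`. -/
theorem hRad_stiffness (m i j : ℕ) (hm : 1 ≤ m) (hi : 1 ≤ i) (hj : 1 ≤ j) :
    (∫ r in (0:ℝ)..1,
        ((m:ℝ)^2 / r * (hRad i m r * hRad j m r) + deriv (hRad i m) r * deriv (hRad j m) r * r)) =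
      muC i m * muC j m * ((m:ℝ) + 2*((min i j : ℝ) - 1)*((min i j : ℝ) + (m:ℝ))) := by
  obtain ⟨k, rfl⟩ : ∃ k, m = k + 1 := ⟨m - 1, by omega⟩
  rcases le_total i j with hij | hij
  · rw [min_eq_left (Nat.cast_le.mpr hij)]
    exact hRad_stiffness_of_le k hi hij
  · rw [min_eq_right (Nat.cast_le.mpr hij), mul_comm (muC i (k + 1)),
      ← hRad_stiffness_of_le k hj hij]
    refine intervalIntegral.integral_congr fun r _ => ?_
    ring
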